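/- arXiv:2605.30458 — 4 statements merged into one kernel-verified Lean document; each statement's English description precedes it below -/
import Mathlib

section
/- Let m > 0, let n be a natural number, and for 0 < q ≤ m define λ̂_n(q) = n(n+1) − 2√(m² − q²)/(m − √(m² − q²)). Then λ̂_n(q) = 0 if and only if q = 2m√(n² + n + 1)/(n² + n + 2). -/
/-- The `n`-th axisymmetric stability eigenvalue
`λ̂_n(q) = n(n+1) - 2√(m² - q²)/(m - √(m² - q²))` of the Reissner–Nordström
inner horizon vanishes iff `q = 2m√(n² + n + 1)/(n² + n + 2)`. -/
theorem stmt_1 (m : ℝ) (hm : 0 < m) (n : ℕ) (q : ℝ) (hq : 0 < q) (hqm : q ≤ m) :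
    (n : ℝ) * (n + 1) -
        2 * Real.sqrt (m ^ 2 - q ^ 2) / (m - Real.sqrt (m ^ 2 - q ^ 2)) = 0 ↔
      q = 2 * m * Real.sqrt ((n : ℝ) ^ 2 + n + 1) / ((n : ℝ) ^ 2 + n + 2) := by
  have hs0 := Real.sqrt_nonneg (m ^ 2 - q ^ 2)
  have hs2 : Real.sqrt (m ^ 2 - q ^ 2) ^ 2 = m ^ 2 - q ^ 2 :=
    Real.sq_sqrt (by nlinarith)
  have ht0 := Real.sqrt_nonneg ((n : ℝ) ^ 2 + n + 1)
  have ht2 : Real.sqrt ((n : ℝ) ^ 2 + n + 1) ^ 2 = (n : ℝ) ^ 2 + n + 1 :=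
    Real.sq_sqrt (by positivity)
  have hsm : Real.sqrt (m ^ 2 - q ^ 2) < m :=
    (Real.sqrt_lt' hm).2 (by linarith [pow_pos hq 2])
  set s := Real.sqrt (m ^ 2 - q ^ 2)
  set t := Real.sqrt ((n : ℝ) ^ 2 + n + 1)
  have hA : (0 : ℝ) < (n : ℝ) ^ 2 + n + 2 := by positivity
  have hleft : (n : ℝ) * (n + 1) - 2 * s / (m - s) = 0 ↔
      s * ((n : ℝ) ^ 2 + n + 2) = ((n : ℝ) ^ 2 + n) * m := by
    rw [sub_eq_zero, eq_div_iff (sub_pos.2 hsm).ne']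
    constructor <;> intro h <;> linarith
  rw [hleft, eq_div_iff hA.ne', ← sq_eq_sq₀ (by positivity) (by positivity),
    ← sq_eq_sq₀ (a := q * _) (by positivity) (by positivity)]
  simp only [mul_pow, hs2, ht2]
  constructor <;> intro h <;> linarith
end

section
/- Let m > 0 and let n be a natural number. Define λ̂_n(q) = n(n+1) − 2√(m² − q²)/(m − √(m² − q²)) for 0 < q ≤ m, and set q_n = 2m√(n² + n + 1)/(n² + n + 2). Then q ↦ λ̂_n(q) is strictly increasing on (0, m], and for every q ∈ (0, m] one has λ̂_n(q) < 0 if and only if q < q_n, and λ̂_n(q) > 0 if and only if q > q_n. -/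
/-- The `n`-th axisymmetric stability eigenvalue of the Reissner–Nordström inner
horizon. -/
noncomputable def lamHat (m : ℝ) (n : ℕ) (q : ℝ) : ℝ :=
  (n : ℝ) * (n + 1) -
    2 * Real.sqrt (m ^ 2 - q ^ 2) / (m - Real.sqrt (m ^ 2 - q ^ 2))

theorem sqrt_sq_sub_sq_lt {m q : ℝ} (hm : 0 < m) (hq : 0 < q) :
    Real.sqrt (m ^ 2 - q ^ 2) < m := by
  rw [Real.sqrt_lt' hm]
  nlinarith

theorem lamHat_strictMonoOn {m : ℝ} (hm : 0 < m) (n : ℕ) :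
    StrictMonoOn (lamHat m n) (Set.Ioc 0 m) := by
  intro p hp q hq hpq
  have hs : Real.sqrt (m ^ 2 - q ^ 2) < Real.sqrt (m ^ 2 - p ^ 2) :=
    Real.sqrt_lt_sqrt (by nlinarith [hq.1, hq.2]) (by nlinarith [hp.1])
  have hp' := sqrt_sq_sub_sq_lt hm hp.1
  have hq' := sqrt_sq_sub_sq_lt hm hq.1
  refine sub_lt_sub_left ?_ _
  rw [div_lt_div_iff₀ (sub_pos.2 hq') (sub_pos.2 hp')]
  nlinarith

/-- The critical charge `q_n` lies in `(0, m]`. -/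
theorem criticalCharge_mem {m : ℝ} (hm : 0 < m) (n : ℕ) :
    2 * m * Real.sqrt ((n : ℝ) ^ 2 + n + 1) / ((n : ℝ) ^ 2 + n + 2) ∈ Set.Ioc 0 m := by
  refine ⟨by positivity, ?_⟩
  have hr : Real.sqrt ((n : ℝ) ^ 2 + n + 1) ^ 2 = (n : ℝ) ^ 2 + n + 1 :=
    Real.sq_sqrt (by positivity)
  rw [div_le_iff₀ (by positivity)]
  nlinarith [mul_nonneg hm.le (sq_nonneg (Real.sqrt ((n : ℝ) ^ 2 + n + 1) - 1))]

theorem lamHat_criticalCharge {m : ℝ} (hm : 0 < m) (n : ℕ) :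
    lamHat m n (2 * m * Real.sqrt ((n : ℝ) ^ 2 + n + 1) / ((n : ℝ) ^ 2 + n + 2)) = 0 := by
  have ha : (0 : ℝ) < (n : ℝ) ^ 2 + n + 2 := by positivity
  have hs : Real.sqrt (m ^ 2 -
      (2 * m * Real.sqrt ((n : ℝ) ^ 2 + n + 1) / ((n : ℝ) ^ 2 + n + 2)) ^ 2) =
      ((n : ℝ) ^ 2 + n) * m / ((n : ℝ) ^ 2 + n + 2) := by
    rw [← Real.sqrt_sq (show 0 ≤ ((n : ℝ) ^ 2 + n) * m / ((n : ℝ) ^ 2 + n + 2) by positivity)]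
    congr 1
    rw [div_pow, mul_pow, Real.sq_sqrt (by positivity)]
    field_simp
    ring
  have hd : m - ((n : ℝ) ^ 2 + n) * m / ((n : ℝ) ^ 2 + n + 2) =
      2 * m / ((n : ℝ) ^ 2 + n + 2) := by
    field_simp
    ring
  rw [lamHat, hs, hd]
  field_simp
  ring

/-- `λ̂_n` is strictly increasing on `(0, m]`, and for `q ∈ (0, m]` it is negative
iff `q < q_n` and positive iff `q > q_n`, where
`q_n = 2m√(n² + n + 1)/(n² + n + 2)`. -/
theorem stmt_2 (m : ℝ) (hm : 0 < m) (n : ℕ) :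
    StrictMonoOn (lamHat m n) (Set.Ioc 0 m) ∧
      ∀ q ∈ Set.Ioc (0 : ℝ) m,
        (lamHat m n q < 0 ↔
            q < 2 * m * Real.sqrt ((n : ℝ) ^ 2 + n + 1) / ((n : ℝ) ^ 2 + n + 2)) ∧
        (0 < lamHat m n q ↔
            2 * m * Real.sqrt ((n : ℝ) ^ 2 + n + 1) / ((n : ℝ) ^ 2 + n + 2) < q) := by
  have hmono := lamHat_strictMonoOn hm n
  have hmem := criticalCharge_mem hm n
  refine ⟨hmono, fun q hq => ⟨?_, ?_⟩⟩
  · rw [← hmono.lt_iff_lt hq hmem, lamHat_criticalCharge hm]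
  · rw [← hmono.lt_iff_lt hmem hq, lamHat_criticalCharge hm]
end

section
/- Let m ≠ 0 and α be real numbers, and define U : ℝ × ℝ → ℝ by U(r, θ) = α(cos²θ + (r(r − 2m)/(2m²))·(3cos²θ − 1)). Then for all real r and θ: sin θ · (d/dr)[ r(r − 2m) · ∂U/∂r (r, θ) ] + (d/dθ)[ sin θ · ∂U/∂θ (r, θ) ] = 0, where ∂U/∂r and ∂U/∂θ denote the partial derivatives of U in its first and second arguments. -/
/-- The pure quadrupole Weyl distortion potential
`U(r, θ) = α(cos²θ + (r(r - 2m)/(2m²))(3cos²θ - 1))`. -/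
noncomputable def quadU (m α r θ : ℝ) : ℝ :=
  α * (Real.cos θ ^ 2 +
    (r * (r - 2 * m) / (2 * m ^ 2)) * (3 * Real.cos θ ^ 2 - 1))

theorem hasDerivAt_quadU_radial (m α r θ : ℝ) :
    HasDerivAt (fun s : ℝ => quadU m α s θ)
      (α * ((2 * r - 2 * m) / (2 * m ^ 2) * (3 * Real.cos θ ^ 2 - 1))) r := by
  have h : HasDerivAt (fun s : ℝ => s * (s - 2 * m)) (2 * r - 2 * m) r :=
    ((hasDerivAt_id' r).mul ((hasDerivAt_id' r).sub_const (2 * m))).congr_deriv (by ring)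
  exact (((h.div_const (2 * m ^ 2)).mul_const (3 * Real.cos θ ^ 2 - 1)).const_add
    (Real.cos θ ^ 2)).const_mul α

theorem hasDerivAt_quadU_angular (m α r θ : ℝ) :
    HasDerivAt (fun t : ℝ => quadU m α r t)
      (-2 * α * (1 + 3 * (r * (r - 2 * m) / (2 * m ^ 2))) *
        (Real.cos θ * Real.sin θ)) θ := by
  have h := (Real.hasDerivAt_cos θ).pow 2
  exact ((h.add (((h.const_mul 3).sub_const 1).const_mul
    (r * (r - 2 * m) / (2 * m ^ 2)))).const_mul α).congr_deriv (by push_cast; ring)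

/-- The quadrupole potential satisfies the vacuum field equation
`sin θ · ∂_r(r(r - 2m) ∂_r U) + ∂_θ(sin θ ∂_θ U) = 0`. -/
theorem stmt_14 (m α : ℝ) (hm : m ≠ 0) :
    ∀ r θ : ℝ,
      Real.sin θ *
          deriv (fun s : ℝ =>
            s * (s - 2 * m) * deriv (fun s' : ℝ => quadU m α s' θ) s) r +
        deriv (fun t : ℝ =>
          Real.sin t * deriv (fun t' : ℝ => quadU m α r t') t) θ = 0 := by
  intro r θ
  have hr : deriv (fun s : ℝ => quadU m α s θ) = fun s =>
      α * ((2 * s - 2 * m) / (2 * m ^ 2) * (3 * Real.cos θ ^ 2 - 1)) :=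
    funext fun s => (hasDerivAt_quadU_radial m α s θ).deriv
  have hθ : deriv (fun t : ℝ => quadU m α r t) = fun t =>
      -2 * α * (1 + 3 * (r * (r - 2 * m) / (2 * m ^ 2))) * (Real.cos t * Real.sin t) :=
    funext fun t => (hasDerivAt_quadU_angular m α r t).deriv
  have hx := hasDerivAt_id' r
  have h₁ := (hx.mul (hx.sub_const (2 * m))).mul
    (((((hx.const_mul 2).sub_const (2 * m)).div_const (2 * m ^ 2)).mul_const
      (3 * Real.cos θ ^ 2 - 1)).const_mul α)
  have h₂ := (Real.hasDerivAt_sin θ).mul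
    (((Real.hasDerivAt_cos θ).mul (Real.hasDerivAt_sin θ)).const_mul
      (-2 * α * (1 + 3 * (r * (r - 2 * m) / (2 * m ^ 2)))))
  rw [hr, hθ]
  refine (congrArg₂ (fun a b => Real.sin θ * a + b) h₁.deriv h₂.deriv).trans ?_
  have hs : Real.cos θ ^ 2 = 1 - Real.sin θ ^ 2 := Real.cos_sq' θ
  simp only [Pi.mul_apply]
  field_simp
  ring_nf
  rw [hs]
  ring
end

section
/- Let α be a real number with −1/2 < α < 1/8. Then for every real θ, −2α² sin²(2θ) − α(5 cos(2θ) + 3) + 1 > 0. -/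
/-- For distortion parameters `-1/2 < α < 1/8`, the sign factor of the Gauss
curvature of the quadrupole Weyl-distorted Schwarzschild horizon,
`-2α² sin²(2θ) - α(5cos(2θ) + 3) + 1`, is everywhere positive. -/
theorem stmt_15 (α : ℝ) (hα₁ : -(1 / 2) < α) (hα₂ : α < 1 / 8) :
    ∀ θ : ℝ,
      0 < -2 * α ^ 2 * Real.sin (2 * θ) ^ 2 -
            α * (5 * Real.cos (2 * θ) + 3) + 1 := by
  intro θ
  rw [Real.sin_sq]
  have hc₁ := Real.neg_one_le_cos (2 * θ)
  have hc₂ := Real.cos_le_one (2 * θ)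
  set c := Real.cos (2 * θ)
  rcases le_total 0 α with h | h
  · have hx : α * c ≤ α := by nlinarith
    nlinarith [mul_nonneg (sub_nonneg.2 hx) (by linarith : 0 ≤ 5 - 2 * (α * c + α))]
  · have hx : α * c ≤ -α := by nlinarith
    nlinarith [mul_nonneg (sub_nonneg.2 hx) (by linarith : 0 ≤ 5 - 2 * (α * c - α))]
end
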